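/- Let A and B be symmetric skew left braces and n ≥ 1. Then A and B are n-isoclinic if and only if there exist a skew left brace C and ideals N₁, N₂ of C such that A is brace-isomorphic to C/N₂, B is brace-isomorphic to C/N₁, and C is n-isoclinic to both A and B. -/

import Mathlib

set_option linter.unusedVariables false

universe u v

/-- A skew left brace: a carrier with two group structures `(A,·)` (written `dmul`) and
`(A,∘)` (written `cmul`) sharing the same identity `ident`, satisfying
`a ∘ (b · c) = (a ∘ b) · a⁻¹ · (a ∘ c)`. -/
class SkewBrace (A : Type u) where
  dmul : A → A → A
  ident : A
  dinv : A → A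
  cmul : A → A → A
  cinv : A → A
  dmul_assoc : ∀ a b c : A, dmul (dmul a b) c = dmul a (dmul b c)
  ident_dmul : ∀ a : A, dmul ident a = a
  dmul_ident : ∀ a : A, dmul a ident = a
  dinv_dmul : ∀ a : A, dmul (dinv a) a = ident
  dmul_dinv : ∀ a : A, dmul a (dinv a) = ident
  cmul_assoc : ∀ a b c : A, cmul (cmul a b) c = cmul a (cmul b c)
  ident_cmul : ∀ a : A, cmul ident a = a
  cmul_ident : ∀ a : A, cmul a ident = a
  cinv_cmul : ∀ a : A, cmul (cinv a) a = ident
  cmul_cinv : ∀ a : A, cmul a (cinv a) = ident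
  compat : ∀ a b c : A, cmul a (dmul b c) = dmul (dmul (cmul a b) (dinv a)) (cmul a c)

namespace SkewBrace

variable {A : Type u} [SkewBrace A]

/-- The lambda map `λ_a(b) = a⁻¹ · (a ∘ b)`. -/
def lam (a b : A) : A := dmul (dinv a) (cmul a b)

/-- The star operation `a * b = λ_a(b) · b⁻¹`. -/
def bstar (a b : A) : A := dmul (lam a b) (dinv b)

/-- The dot commutator `[a,b]· = a · b · a⁻¹ · b⁻¹`. -/
def dcomm (a b : A) : A := dmul (dmul (dmul a b) (dinv a)) (dinv b)

/-- The circle commutator `[a,b]∘ = a ∘ b ∘ ā ∘ b̄`. -/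
def ccomm (a b : A) : A := cmul (cmul (cmul a b) (cinv a)) (cinv b)

/-- Membership in the subgroup of `(A,·)` generated by a subset. -/
inductive dclosure (S : Set A) : A → Prop
  | mem {x : A} : x ∈ S → dclosure S x
  | one : dclosure S ident
  | mul {x y : A} : dclosure S x → dclosure S y → dclosure S (dmul x y)
  | inv {x : A} : dclosure S x → dclosure S (dinv x)

/-- The subgroup of `(A,·)` generated by a subset, as a set. -/
def dcl (S : Set A) : Set A := {x | dclosure S x}

/-- Membership in the subgroup of `(A,∘)` generated by a subset. -/
inductive cclosure (S : Set A) : A → Prop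
  | mem {x : A} : x ∈ S → cclosure S x
  | one : cclosure S ident
  | mul {x y : A} : cclosure S x → cclosure S y → cclosure S (cmul x y)
  | inv {x : A} : cclosure S x → cclosure S (cinv x)

/-- The subgroup of `(A,∘)` generated by a subset, as a set. -/
def ccl (S : Set A) : Set A := {x | cclosure S x}

/-- The set `{x * y : x ∈ I, y ∈ J}` (star values). -/
def starSet (I J : Set A) : Set A := {x | ∃ a ∈ I, ∃ b ∈ J, x = bstar a b}

/-- The set of dot commutators `[a,b]·` with `a ∈ I`, `b ∈ J`. -/
def dcommSet (I J : Set A) : Set A := {x | ∃ a ∈ I, ∃ b ∈ J, x = dcomm a b}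

/-- The set of circle commutators `[a,b]∘` with `a ∈ I`, `b ∈ J`. -/
def ccommSet (I J : Set A) : Set A := {x | ∃ a ∈ I, ∃ b ∈ J, x = ccomm a b}

/-- The lower central series `Γ_n(A)` of the skew brace `A` (`Gamma A n = Γ_n(A)` for `n ≥ 1`):
`Γ₁(A) = A` and `Γ_n(A) = ⟨A * Γ_{n-1}(A), Γ_{n-1}(A) * A, [A,Γ_{n-1}(A)]·⟩·`. -/
def Gamma (A : Type u) [SkewBrace A] : ℕ → Set A
  | 0 => Set.univ
  | 1 => Set.univ
  | (n+2) =>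
      dcl (starSet Set.univ (Gamma A (n+1)) ∪ starSet (Gamma A (n+1)) Set.univ ∪
        dcommSet Set.univ (Gamma A (n+1)))

/-- The lower central series `γ_n(A,∘)` of the group `(A,∘)`
(`gammaCirc A n = γ_n(A,∘)` for `n ≥ 1`). -/
def gammaCirc (A : Type u) [SkewBrace A] : ℕ → Set A
  | 0 => Set.univ
  | 1 => Set.univ
  | (n+2) => ccl (ccommSet (gammaCirc A (n+1)) Set.univ)

/-- The series `Γ̄_n(A)`: `Γ̄₁(A) = A`, `Γ̄_n(A) = ⟨A * Γ̄_{n-1}(A), [A, Γ̄_{n-1}(A)]·⟩·`. -/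
def GammaBar (A : Type u) [SkewBrace A] : ℕ → Set A
  | 0 => Set.univ
  | 1 => Set.univ
  | (n+2) =>
      dcl (starSet Set.univ (GammaBar A (n+1)) ∪ dcommSet Set.univ (GammaBar A (n+1)))

/-- The annihilator series: `AnnS A n = Ann_n(A)`, with `Ann_0(A) = 1` and
`Ann_n(A) = {a | a*b, b*a, [a,b]· ∈ Ann_{n-1}(A) for all b}`. -/
def AnnS (A : Type u) [SkewBrace A] : ℕ → Set A
  | 0 => {ident}
  | (n+1) => {a | ∀ b : A, bstar a b ∈ AnnS A n ∧ bstar b a ∈ AnnS A n ∧ dcomm a b ∈ AnnS A n}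

/-- The alphabet `X = {γ·, γ̄·, *, *̄}` of brace commutator symbols. -/
inductive BWord : Type
  | g | gbar | s | sbar

/-- Evaluation of a single symbol of `X`. -/
def evalX : BWord → A → A → A
  | BWord.g => dcomm
  | BWord.gbar => fun a b => dcomm b a
  | BWord.s => bstar
  | BWord.sbar => fun a b => bstar b a

/-- `evalW e a n` is the value `m(a₀ a₁ ⋯ a_n)` of the degree-`n` brace commutator word
`m = (e 0)(e 1)⋯(e (n-1))` on the arguments `a 0, …, a n`:
`m(a₀ ⋯ a_n) = (e 0)(a₀, (e 1)(a₁, …, (e (n-1))(a_{n-1}, a_n)⋯))`. -/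
def evalW : (ℕ → BWord) → (ℕ → A) → ℕ → A
  | _, a, 0 => a 0
  | e, a, (n+1) => evalX (e 0) (a 0) (evalW (fun i => e (i+1)) (fun i => a (i+1)) n)

/-- `Asub A t = A_{(t)}`, the subgroup of `(A,·)` generated by all values of brace commutator
words of degree `≥ t`. -/
def Asub (A : Type u) [SkewBrace A] (t : ℕ) : Set A :=
  dcl {x | ∃ s : ℕ, t ≤ s ∧ ∃ (e : ℕ → BWord) (a : ℕ → A), x = evalW e a s}

/-- `Sset A r = S_r(A)`, the set of all values of brace commutator words of degree exactly `r`
(`S_0(A) = A`). -/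
def Sset (A : Type u) [SkewBrace A] (r : ℕ) : Set A :=
  {x | ∃ (e : ℕ → BWord) (a : ℕ → A), x = evalW e a r}

/-- `cosetRel I a b` says that `b` lies in the coset `I · a`. -/
def cosetRel (I : Set A) (a b : A) : Prop := ∃ c ∈ I, b = dmul c a

/-- The class `I_n`: the maps `φ_m : (A/Ann_n(A))^{n+1} → A_{(n)}`,
`(Ann_n(A)a₁, …, Ann_n(A)a_{n+1}) ↦ m(a₁⋯a_{n+1})`, are well defined for every word `m` of
degree `n`. -/
def InClass (A : Type u) [SkewBrace A] (n : ℕ) : Prop :=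
  ∀ (e : ℕ → BWord) (a b : ℕ → A),
    (∀ i : ℕ, i ≤ n → cosetRel (AnnS A n) (a i) (b i)) →
    evalW e b n = evalW e a n

/-- A skew left brace `(A,·,∘)` is symmetric if `(A,∘,·)` is also a skew left brace, i.e.
`a · (b ∘ c) = (a · b) ∘ ā ∘ (a · c)`. -/
def IsSymmetric (A : Type u) [SkewBrace A] : Prop :=
  ∀ a b c : A, dmul a (cmul b c) = cmul (cmul (dmul a b) (cinv a)) (dmul a c)

/-- A sub-skew brace: a subset which is a subgroup of both `(A,·)` and `(A,∘)`. -/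
structure IsSubBrace (A : Type u) [SkewBrace A] (S : Set A) : Prop where
  ident_mem : ident ∈ S
  dmul_mem : ∀ {x y : A}, x ∈ S → y ∈ S → dmul x y ∈ S
  dinv_mem : ∀ {x : A}, x ∈ S → dinv x ∈ S
  cmul_mem : ∀ {x y : A}, x ∈ S → y ∈ S → cmul x y ∈ S
  cinv_mem : ∀ {x : A}, x ∈ S → cinv x ∈ S

/-- An ideal of a skew brace: a subgroup of `(A,·)`, normal in `(A,·)` and `(A,∘)`,
and invariant under all `λ_a`. -/
structure IsIdeal (A : Type u) [SkewBrace A] (I : Set A) : Prop where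
  ident_mem : ident ∈ I
  dmul_mem : ∀ {x y : A}, x ∈ I → y ∈ I → dmul x y ∈ I
  dinv_mem : ∀ {x : A}, x ∈ I → dinv x ∈ I
  dconj_mem : ∀ (a : A) {x : A}, x ∈ I → dmul (dmul a x) (dinv a) ∈ I
  cconj_mem : ∀ (a : A) {x : A}, x ∈ I → cmul (cmul a x) (cinv a) ∈ I
  lam_mem : ∀ (a : A) {x : A}, x ∈ I → lam a x ∈ I

/-- A homomorphism of skew braces. -/
structure IsBraceHom {A : Type u} {B : Type v} [SkewBrace A] [SkewBrace B] (f : A → B) : Prop where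
  map_dmul : ∀ x y : A, f (dmul x y) = dmul (f x) (f y)
  map_cmul : ∀ x y : A, f (cmul x y) = cmul (f x) (f y)

/-- The data of an isoclinism of skew braces along ideals `I` of `A` and `J` of `B`:
`ξ` induces a brace isomorphism `A/I → B/J` and `θ` restricts to a brace isomorphism
`Γ₂(A) → Γ₂(B)` compatible with the commutator and star maps. -/
structure IsoclinismData (A : Type u) (B : Type v) [SkewBrace A] [SkewBrace B]
    (I : Set A) (J : Set B) (ξ θ : A → B) : Prop where
  xi_resp : ∀ a a' : A, cosetRel I a a' ↔ cosetRel J (ξ a) (ξ a')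
  xi_surj : ∀ b : B, ∃ a : A, cosetRel J b (ξ a)
  xi_dmul : ∀ a a' : A, cosetRel J (dmul (ξ a) (ξ a')) (ξ (dmul a a'))
  xi_cmul : ∀ a a' : A, cosetRel J (cmul (ξ a) (ξ a')) (ξ (cmul a a'))
  theta_maps : ∀ x ∈ Gamma A 2, θ x ∈ Gamma B 2
  theta_inj : ∀ x ∈ Gamma A 2, ∀ y ∈ Gamma A 2, θ x = θ y → x = y
  theta_surj : ∀ y ∈ Gamma B 2, ∃ x ∈ Gamma A 2, θ x = y
  theta_dmul : ∀ x ∈ Gamma A 2, ∀ y ∈ Gamma A 2, θ (dmul x y) = dmul (θ x) (θ y)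
  theta_cmul : ∀ x ∈ Gamma A 2, ∀ y ∈ Gamma A 2, θ (cmul x y) = cmul (θ x) (θ y)
  compat_dcomm : ∀ a₁ a₂ : A, ∀ b₁ b₂ : B, cosetRel J b₁ (ξ a₁) → cosetRel J b₂ (ξ a₂) →
    θ (dcomm a₁ a₂) = dcomm b₁ b₂
  compat_star : ∀ a₁ a₂ : A, ∀ b₁ b₂ : B, cosetRel J b₁ (ξ a₁) → cosetRel J b₂ (ξ a₂) →
    θ (bstar a₁ a₂) = bstar b₁ b₂

/-- Isoclinism (1-isoclinism) of skew left braces. -/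
def Isoclinic (A : Type u) (B : Type v) [SkewBrace A] [SkewBrace B] : Prop :=
  ∃ ξ θ : A → B, IsoclinismData A B (AnnS A 1) (AnnS B 1) ξ θ

/-- The data of an `n`-isoclinism of skew braces: `ξ` induces a brace isomorphism
`A/Ann_n(A) → B/Ann_n(B)` and `θ` restricts to a brace isomorphism `A_{(n)} → B_{(n)}`
commuting with all brace commutator word maps of degree `n`. -/
structure IsoclinismDataN (A : Type u) (B : Type v) [SkewBrace A] [SkewBrace B]
    (n : ℕ) (ξ θ : A → B) : Prop where
  xi_resp : ∀ a a' : A, cosetRel (AnnS A n) a a' ↔ cosetRel (AnnS B n) (ξ a) (ξ a')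
  xi_surj : ∀ b : B, ∃ a : A, cosetRel (AnnS B n) b (ξ a)
  xi_dmul : ∀ a a' : A, cosetRel (AnnS B n) (dmul (ξ a) (ξ a')) (ξ (dmul a a'))
  xi_cmul : ∀ a a' : A, cosetRel (AnnS B n) (cmul (ξ a) (ξ a')) (ξ (cmul a a'))
  theta_maps : ∀ x ∈ Asub A n, θ x ∈ Asub B n
  theta_inj : ∀ x ∈ Asub A n, ∀ y ∈ Asub A n, θ x = θ y → x = y
  theta_surj : ∀ y ∈ Asub B n, ∃ x ∈ Asub A n, θ x = y
  theta_dmul : ∀ x ∈ Asub A n, ∀ y ∈ Asub A n, θ (dmul x y) = dmul (θ x) (θ y)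
  theta_cmul : ∀ x ∈ Asub A n, ∀ y ∈ Asub A n, θ (cmul x y) = cmul (θ x) (θ y)
  compat : ∀ (e : ℕ → BWord) (a : ℕ → A) (b : ℕ → B),
    (∀ i : ℕ, i ≤ n → cosetRel (AnnS B n) (b i) (ξ (a i))) →
    θ (evalW e a n) = evalW e b n

/-- `n`-isoclinism of skew left braces. -/
def IsoclinicN (A : Type u) (B : Type v) [SkewBrace A] [SkewBrace B] (n : ℕ) : Prop :=
  ∃ ξ θ : A → B, IsoclinismDataN A B n ξ θ

/-- The product set `S · T = {s · t : s ∈ S, t ∈ T}` in `(A,·)`. -/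
def setDProd (S T : Set A) : Set A := {x | ∃ s ∈ S, ∃ t ∈ T, x = dmul s t}

/-- The product set `S ∘ T = {s ∘ t : s ∈ S, t ∈ T}` in `(A,∘)`. -/
def setCProd (S T : Set A) : Set A := {x | ∃ s ∈ S, ∃ t ∈ T, x = cmul s t}

/-- The skew brace structure on a sub-skew brace. -/
def subBrace (S : Set A) (h : IsSubBrace A S) : SkewBrace S where
  dmul x y := ⟨dmul x.1 y.1, h.dmul_mem x.2 y.2⟩
  ident := ⟨ident, h.ident_mem⟩
  dinv x := ⟨dinv x.1, h.dinv_mem x.2⟩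
  cmul x y := ⟨cmul x.1 y.1, h.cmul_mem x.2 y.2⟩
  cinv x := ⟨cinv x.1, h.cinv_mem x.2⟩
  dmul_assoc a b c := Subtype.ext (dmul_assoc a.1 b.1 c.1)
  ident_dmul a := Subtype.ext (ident_dmul a.1)
  dmul_ident a := Subtype.ext (dmul_ident a.1)
  dinv_dmul a := Subtype.ext (dinv_dmul a.1)
  dmul_dinv a := Subtype.ext (dmul_dinv a.1)
  cmul_assoc a b c := Subtype.ext (cmul_assoc a.1 b.1 c.1)
  ident_cmul a := Subtype.ext (ident_cmul a.1)
  cmul_ident a := Subtype.ext (cmul_ident a.1)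
  cinv_cmul a := Subtype.ext (cinv_cmul a.1)
  cmul_cinv a := Subtype.ext (cmul_cinv a.1)
  compat a b c := Subtype.ext (compat a.1 b.1 c.1)

/-- The direct product of two skew braces, with componentwise operations. -/
instance prodBrace (A : Type u) (B : Type v) [SkewBrace A] [SkewBrace B] :
    SkewBrace (A × B) where
  dmul p q := (dmul p.1 q.1, dmul p.2 q.2)
  ident := (ident, ident)
  dinv p := (dinv p.1, dinv p.2)
  cmul p q := (cmul p.1 q.1, cmul p.2 q.2)
  cinv p := (cinv p.1, cinv p.2)
  dmul_assoc a b c := Prod.ext_iff.mpr ⟨dmul_assoc _ _ _, dmul_assoc _ _ _⟩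
  ident_dmul a := Prod.ext_iff.mpr ⟨ident_dmul _, ident_dmul _⟩
  dmul_ident a := Prod.ext_iff.mpr ⟨dmul_ident _, dmul_ident _⟩
  dinv_dmul a := Prod.ext_iff.mpr ⟨dinv_dmul _, dinv_dmul _⟩
  dmul_dinv a := Prod.ext_iff.mpr ⟨dmul_dinv _, dmul_dinv _⟩
  cmul_assoc a b c := Prod.ext_iff.mpr ⟨cmul_assoc _ _ _, cmul_assoc _ _ _⟩
  ident_cmul a := Prod.ext_iff.mpr ⟨ident_cmul _, ident_cmul _⟩
  cmul_ident a := Prod.ext_iff.mpr ⟨cmul_ident _, cmul_ident _⟩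
  cinv_cmul a := Prod.ext_iff.mpr ⟨cinv_cmul _, cinv_cmul _⟩
  cmul_cinv a := Prod.ext_iff.mpr ⟨cmul_cinv _, cmul_cinv _⟩
  compat a b c := Prod.ext_iff.mpr ⟨compat _ _ _, compat _ _ _⟩

end SkewBrace

open SkewBrace

/-- Auxiliary predicate for `isoclinicN_iff_common_quotient`: there are ideals `N₁, N₂` of `C`
with `A ≅ C/N₂` and `B ≅ C/N₁` (encoded via surjective brace homomorphisms with kernels `N₂`
resp. `N₁`), and `C` is `n`-isoclinic to both `A` and `B`. -/
def Stmt12Concl (A B : Type u) [SkewBrace A] [SkewBrace B] (n : ℕ)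
    (C : Type u) [SkewBrace C] : Prop :=
  ∃ (N₁ N₂ : Set C) (pA : C → A) (pB : C → B),
    IsIdeal C N₁ ∧ IsIdeal C N₂ ∧
    IsBraceHom pA ∧ Function.Surjective pA ∧ (∀ c : C, pA c = ident ↔ c ∈ N₂) ∧
    IsBraceHom pB ∧ Function.Surjective pB ∧ (∀ c : C, pB c = ident ↔ c ∈ N₁) ∧
    IsoclinicN C A n ∧ IsoclinicN C B n

namespace SkewBrace

section Basic

variable {A : Type u} [SkewBrace A]

/-- The group `(A,·)`. -/
abbrev dotGroup (A : Type u) [SkewBrace A] : Group A where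
  mul := dmul
  one := ident
  inv := dinv
  mul_assoc := dmul_assoc
  one_mul := ident_dmul
  mul_one := dmul_ident
  inv_mul_cancel := dinv_dmul

/-- The group `(A,∘)`. -/
abbrev circGroup (A : Type u) [SkewBrace A] : Group A where
  mul := cmul
  one := ident
  inv := cinv
  mul_assoc := cmul_assoc
  one_mul := ident_cmul
  mul_one := cmul_ident
  inv_mul_cancel := cinv_cmul

lemma dmul_left_cancel {a b c : A} (h : dmul a b = dmul a c) : b = c :=
  letI := dotGroup A
  mul_left_cancel (a := a) h

lemma dmul_right_cancel {a b c : A} (h : dmul b a = dmul c a) : b = c :=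
  letI := dotGroup A
  mul_right_cancel (b := a) h

lemma dinv_eq_of_dmul {a b : A} (h : dmul a b = ident) : dinv a = b :=
  letI := dotGroup A
  inv_eq_of_mul_eq_one_right (a := a) h

lemma cinv_eq_of_cmul {a b : A} (h : cmul a b = ident) : cinv a = b :=
  letI := circGroup A
  inv_eq_of_mul_eq_one_right (a := a) h

lemma dinv_dmul_rev (a b : A) : dinv (dmul a b) = dmul (dinv b) (dinv a) :=
  letI := dotGroup A
  mul_inv_rev a b

lemma cinv_cmul_rev (a b : A) : cinv (cmul a b) = cmul (cinv b) (cinv a) :=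
  letI := circGroup A
  mul_inv_rev a b

lemma dmul_dinv_cancel_left (a b : A) : dmul a (dmul (dinv a) b) = b :=
  letI := dotGroup A
  mul_inv_cancel_left a b

lemma dmul_dinv_cancel_right (a b : A) : dmul (dmul a b) (dinv b) = a :=
  letI := dotGroup A
  mul_inv_cancel_right a b

lemma dinv_dmul_cancel_right (a b : A) : dmul (dmul a (dinv b)) b = a :=
  letI := dotGroup A
  inv_mul_cancel_right a b

lemma dmul_dinv_eq_ident {a b : A} : dmul a (dinv b) = ident ↔ a = b :=
  letI := dotGroup A
  mul_inv_eq_one (a := a) (b := b)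

lemma dmul_lam (a b : A) : dmul a (lam a b) = cmul a b :=
  dmul_dinv_cancel_left a _

lemma bstar_dmul (a b : A) : dmul (bstar a b) b = lam a b :=
  dinv_dmul_cancel_right _ _

lemma bstar_eq_ident {a b : A} : bstar a b = ident ↔ cmul a b = dmul a b := by
  rw [bstar, dmul_dinv_eq_ident, ← dmul_lam]
  exact ⟨fun h => by rw [h], dmul_left_cancel⟩

lemma dcomm_eq_ident {a b : A} : dcomm a b = ident ↔ dmul b a = dmul a b := by
  rw [dcomm, dmul_dinv_eq_ident]
  refine ⟨fun h => ?_, fun h => ?_⟩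
  · rw [← h, dinv_dmul_cancel_right, h]
  · rw [← h, dmul_dinv_cancel_right]

lemma lam_dmul (a b c : A) : lam a (dmul b c) = dmul (lam a b) (lam a c) := by
  simp only [lam, compat, dmul_assoc]

lemma lam_ident (a : A) : lam a ident = ident := by
  rw [lam, cmul_ident, dinv_dmul]

lemma lam_dinv (a b : A) : lam a (dinv b) = dinv (lam a b) :=
  (dinv_eq_of_dmul (by rw [← lam_dmul, dmul_dinv, lam_ident])).symm

end Basic

namespace IsBraceHom

variable {A : Type u} {B : Type v} [SkewBrace A] [SkewBrace B] {f : A → B}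

lemma map_ident (hf : IsBraceHom f) : f ident = ident :=
  dmul_left_cancel (a := f ident) (by rw [← hf.map_dmul, dmul_ident, dmul_ident])

lemma map_dinv (hf : IsBraceHom f) (a : A) : f (dinv a) = dinv (f a) :=
  (dinv_eq_of_dmul (by rw [← hf.map_dmul, dmul_dinv, hf.map_ident])).symm

lemma map_cinv (hf : IsBraceHom f) (a : A) : f (cinv a) = cinv (f a) :=
  (cinv_eq_of_cmul (by rw [← hf.map_cmul, cmul_cinv, hf.map_ident])).symm

lemma map_bstar (hf : IsBraceHom f) (a b : A) : f (bstar a b) = bstar (f a) (f b) := by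
  simp only [bstar, lam, hf.map_dmul, hf.map_cmul, hf.map_dinv]

lemma map_dcomm (hf : IsBraceHom f) (a b : A) : f (dcomm a b) = dcomm (f a) (f b) := by
  simp only [dcomm, hf.map_dmul, hf.map_dinv]

lemma map_evalW (hf : IsBraceHom f) (e : ℕ → BWord) (a : ℕ → A) (n : ℕ) :
    f (evalW e a n) = evalW e (fun i => f (a i)) n := by
  induction n generalizing e a with
  | zero => rfl
  | succ n ih =>
    simp only [evalW, ← ih]
    cases e 0
    · exact hf.map_dcomm _ _
    · exact hf.map_dcomm _ _
    · exact hf.map_bstar _ _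
    · exact hf.map_bstar _ _

lemma isIdeal_ker (hf : IsBraceHom f) : IsIdeal A {a | f a = ident} where
  ident_mem := hf.map_ident
  dmul_mem {x y} hx hy := by
    simp only [Set.mem_ofPred_eq] at *
    rw [hf.map_dmul, hx, hy, dmul_ident]
  dinv_mem {x} hx := by
    simp only [Set.mem_ofPred_eq] at *
    rw [hf.map_dinv, hx]
    exact dinv_eq_of_dmul (dmul_ident _)
  dconj_mem a {x} hx := by
    simp only [Set.mem_ofPred_eq] at *
    rw [hf.map_dmul, hf.map_dmul, hx, hf.map_dinv, dmul_ident, dmul_dinv]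
  cconj_mem a {x} hx := by
    simp only [Set.mem_ofPred_eq] at *
    rw [hf.map_cmul, hf.map_cmul, hx, hf.map_cinv, cmul_ident, cmul_cinv]
  lam_mem a {x} hx := by
    simp only [Set.mem_ofPred_eq] at *
    rw [lam, hf.map_dmul, hf.map_cmul, hx, hf.map_dinv, cmul_ident, dinv_dmul]

lemma cosetRel_iff (hf : IsBraceHom f) {I : Set A} (hI : ∀ a, f a = ident ↔ a ∈ I) {a b : A} :
    cosetRel I a b ↔ f a = f b := by
  constructor
  · rintro ⟨c, hc, rfl⟩
    rw [hf.map_dmul, (hI c).2 hc, ident_dmul]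
  · intro h
    refine ⟨dmul b (dinv a), (hI _).1 ?_, (dinv_dmul_cancel_right _ _).symm⟩
    rw [hf.map_dmul, hf.map_dinv, h, dmul_dinv]

end IsBraceHom

section Annihilator

variable {A : Type u} [SkewBrace A]

/-- Membership in the annihilator: `c` commutes with everything for both operations, and the two
operations agree on it. -/
def IsAnn (c : A) : Prop :=
  ∀ b : A, cmul c b = dmul c b ∧ cmul b c = dmul c b ∧ dmul b c = dmul c b

lemma isAnn_iff {c : A} :
    IsAnn c ↔ ∀ b : A, bstar c b = ident ∧ bstar b c = ident ∧ dcomm c b = ident := by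
  simp only [IsAnn, bstar_eq_ident, dcomm_eq_ident]
  refine forall_congr' fun b => ⟨fun h => ⟨h.1, h.2.1.trans h.2.2.symm, h.2.2⟩,
    fun h => ⟨h.1, h.2.1.trans h.2.2, h.2.2⟩⟩

lemma isAnn_ident : IsAnn (ident : A) := fun b => by
  simp only [ident_cmul, cmul_ident, ident_dmul, dmul_ident, and_self]

lemma IsAnn.dmul_isAnn {c d : A} (hc : IsAnn c) (hd : IsAnn d) : IsAnn (dmul c d) := fun b => by
  refine ⟨?_, ?_, ?_⟩
  · rw [← (hc d).1, cmul_assoc, (hd b).1, (hc _).1, (hc d).1, dmul_assoc]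
  · rw [← (hd c).2.1.trans ((hd c).2.2.symm), ← cmul_assoc, (hc b).2.1, (hd _).2.1, (hd c).2.1,
      dmul_assoc]
  · rw [← dmul_assoc, (hc b).2.2, dmul_assoc, (hd b).2.2, dmul_assoc]

lemma IsAnn.cinv_eq {c : A} (hc : IsAnn c) : cinv c = dinv c :=
  cinv_eq_of_cmul (by rw [(hc _).1, dmul_dinv])

lemma IsAnn.dinv_isAnn {c : A} (hc : IsAnn c) : IsAnn (dinv c) := fun b => by
  have key : dmul c (dmul (dinv c) b) = b := dmul_dinv_cancel_left _ _
  refine ⟨?_, ?_, ?_⟩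
  · conv_lhs => rw [← key, ← (hc _).1, ← hc.cinv_eq, ← cmul_assoc, cinv_cmul, ident_cmul]
    rw [hc.cinv_eq]
  · conv_lhs => rw [← key, ← (hc _).2.1, ← hc.cinv_eq, cmul_assoc, cmul_cinv, cmul_ident]
    rw [hc.cinv_eq]
  · conv_lhs => rw [← key, ← (hc _).2.2, dmul_dinv_cancel_right]

/-- Congruence modulo the annihilator. -/
def annSetoid (A : Type u) [SkewBrace A] : Setoid A where
  r x y := ∃ c, IsAnn c ∧ y = dmul c x
  iseqv :=
    { refl := fun x => ⟨ident, isAnn_ident, (ident_dmul x).symm⟩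
      symm := by
        rintro x _ ⟨c, hc, rfl⟩
        exact ⟨dinv c, hc.dinv_isAnn, by rw [← dmul_assoc, dinv_dmul, ident_dmul]⟩
      trans := by
        rintro x _ _ ⟨c, hc, rfl⟩ ⟨d, hd, rfl⟩
        exact ⟨dmul d c, hd.dmul_isAnn hc, by rw [dmul_assoc]⟩ }

/-- The quotient of a skew brace by its annihilator. -/
def AnnQuot (A : Type u) [SkewBrace A] : Type u := Quotient (annSetoid A)

/-- The quotient map onto `AnnQuot A`. -/
def AnnQuot.mk (a : A) : AnnQuot A := Quotient.mk (annSetoid A) a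

lemma AnnQuot.ind {p : AnnQuot A → Prop} (h : ∀ a, p (AnnQuot.mk a)) (q : AnnQuot A) : p q :=
  Quotient.ind h q

instance : SkewBrace (AnnQuot A) where
  dmul := Quotient.map₂ dmul (by
    rintro x _ ⟨c, hc, rfl⟩ y _ ⟨d, hd, rfl⟩
    refine ⟨dmul c d, hc.dmul_isAnn hd, ?_⟩
    rw [dmul_assoc, ← dmul_assoc x, (hd x).2.2, dmul_assoc, dmul_assoc])
  ident := AnnQuot.mk ident
  dinv := Quotient.map dinv (by
    rintro x _ ⟨c, hc, rfl⟩
    exact ⟨dinv c, hc.dinv_isAnn, by rw [dinv_dmul_rev, (hc.dinv_isAnn _).2.2]⟩)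
  cmul := Quotient.map₂ cmul (by
    rintro x _ ⟨c, hc, rfl⟩ y _ ⟨d, hd, rfl⟩
    refine ⟨dmul c d, hc.dmul_isAnn hd, ?_⟩
    rw [← (hc x).1, ← (hd y).1, cmul_assoc, ← cmul_assoc x, (hd x).2.1, ← (hd x).1, cmul_assoc,
      (hc _).1, (hd _).1, dmul_assoc])
  cinv := Quotient.map cinv (by
    rintro x _ ⟨c, hc, rfl⟩
    exact ⟨dinv c, hc.dinv_isAnn, by rw [← (hc x).1, cinv_cmul_rev, hc.cinv_eq, (hc.dinv_isAnn _).2.1]⟩)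
  dmul_assoc := by
    refine AnnQuot.ind fun a => AnnQuot.ind fun b => AnnQuot.ind fun c => ?_
    exact congrArg AnnQuot.mk (dmul_assoc a b c)
  ident_dmul := AnnQuot.ind fun a => congrArg AnnQuot.mk (ident_dmul a)
  dmul_ident := AnnQuot.ind fun a => congrArg AnnQuot.mk (dmul_ident a)
  dinv_dmul := AnnQuot.ind fun a => congrArg AnnQuot.mk (dinv_dmul a)
  dmul_dinv := AnnQuot.ind fun a => congrArg AnnQuot.mk (dmul_dinv a)
  cmul_assoc := by
    refine AnnQuot.ind fun a => AnnQuot.ind fun b => AnnQuot.ind fun c => ?_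
    exact congrArg AnnQuot.mk (cmul_assoc a b c)
  ident_cmul := AnnQuot.ind fun a => congrArg AnnQuot.mk (ident_cmul a)
  cmul_ident := AnnQuot.ind fun a => congrArg AnnQuot.mk (cmul_ident a)
  cinv_cmul := AnnQuot.ind fun a => congrArg AnnQuot.mk (cinv_cmul a)
  cmul_cinv := AnnQuot.ind fun a => congrArg AnnQuot.mk (cmul_cinv a)
  compat := by
    refine AnnQuot.ind fun a => AnnQuot.ind fun b => AnnQuot.ind fun c => ?_
    exact congrArg AnnQuot.mk (compat a b c)

lemma AnnQuot.isBraceHom_mk : IsBraceHom (AnnQuot.mk : A → AnnQuot A) :=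
  ⟨fun _ _ => rfl, fun _ _ => rfl⟩

lemma AnnQuot.mk_eq_ident {a : A} : AnnQuot.mk a = ident ↔ IsAnn a := by
  refine (Quotient.eq (r := annSetoid A) (x := a) (y := ident)).trans ?_
  constructor
  · rintro ⟨c, hc, h⟩
    have := hc.dinv_isAnn
    rwa [dinv_eq_of_dmul h.symm] at this
  · intro h
    exact ⟨dinv a, h.dinv_isAnn, (dinv_dmul a).symm⟩

/-- `Ann_n(A)` is the kernel of a surjective homomorphism of skew braces. -/
theorem exists_hom_ker_annS (A : Type u) [SkewBrace A] (n : ℕ) :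
    ∃ (Q : Type u) (_ : SkewBrace Q) (f : A → Q),
      IsBraceHom f ∧ Function.Surjective f ∧ ∀ a, f a = ident ↔ a ∈ AnnS A n := by
  induction n with
  | zero => exact ⟨A, inferInstance, id, ⟨fun _ _ => rfl, fun _ _ => rfl⟩, fun a => ⟨a, rfl⟩,
      fun a => Iff.rfl⟩
  | succ n ih =>
    obtain ⟨Q, _, f, hf, hs, hk⟩ := ih
    refine ⟨AnnQuot Q, inferInstance, fun a => AnnQuot.mk (f a),
      ⟨fun x y => congrArg AnnQuot.mk (hf.map_dmul x y),
        fun x y => congrArg AnnQuot.mk (hf.map_cmul x y)⟩, ?_, fun a => ?_⟩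
    · exact AnnQuot.ind fun q => (hs q).imp fun a h => congrArg AnnQuot.mk h
    · rw [AnnQuot.mk_eq_ident, isAnn_iff, hs.forall]
      simp only [← hf.map_bstar, ← hf.map_dcomm, hk]
      rfl

end Annihilator

section Asub

variable {A : Type u} [SkewBrace A]

lemma ident_mem_Asub (n : ℕ) : (ident : A) ∈ Asub A n := dclosure.one

lemma dmul_mem_Asub {n : ℕ} {x y : A} (hx : x ∈ Asub A n) (hy : y ∈ Asub A n) :
    dmul x y ∈ Asub A n := dclosure.mul hx hy

lemma dinv_mem_Asub {n : ℕ} {x : A} (hx : x ∈ Asub A n) : dinv x ∈ Asub A n := dclosure.inv hx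

lemma evalW_mem_Asub (e : ℕ → BWord) (a : ℕ → A) (n : ℕ) : evalW e a n ∈ Asub A n :=
  dclosure.mem ⟨n, le_rfl, e, a, rfl⟩

lemma lam_mem_Asub {n : ℕ} (a : A) {x : A} (hx : x ∈ Asub A n) : lam a x ∈ Asub A n := by
  induction hx with
  | mem hx =>
    obtain ⟨s, hs, e, w, rfl⟩ := hx
    rw [← bstar_dmul]
    refine dmul_mem_Asub (dclosure.mem ⟨s + 1, by omega,
      fun i => Nat.casesOn i BWord.s e, fun i => Nat.casesOn i a w, rfl⟩)
      (dclosure.mem ⟨s, hs, e, w, rfl⟩)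
  | one => rw [lam_ident]; exact ident_mem_Asub n
  | mul _ _ hx hy => rw [lam_dmul]; exact dmul_mem_Asub hx hy
  | inv _ hx => rw [lam_dinv]; exact dinv_mem_Asub hx

lemma cmul_mem_Asub {n : ℕ} {x y : A} (hx : x ∈ Asub A n) (hy : y ∈ Asub A n) :
    cmul x y ∈ Asub A n := by
  rw [← dmul_lam]
  exact dmul_mem_Asub hx (lam_mem_Asub x hy)

/-- Values of words of degree at least `n` are values of words of degree `n`. -/
lemma exists_evalW_add (e : ℕ → BWord) (a : ℕ → A) (n k : ℕ) :
    ∃ a' : ℕ → A, evalW e a (n + k) = evalW e a' n := by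
  induction n generalizing e a with
  | zero => exact ⟨fun _ => evalW e a (0 + k), rfl⟩
  | succ n ih =>
    obtain ⟨a', h⟩ := ih (fun i => e (i + 1)) (fun i => a (i + 1))
    refine ⟨fun i => Nat.casesOn i (a 0) a', ?_⟩
    rw [Nat.add_right_comm]
    exact congrArg (evalX (e 0) (a 0)) h

/-- `A_{(n)}` is generated by the values of words of degree exactly `n`. -/
lemma Asub_induction {n : ℕ} {p : A → Prop} (mem : ∀ e a, p (evalW e a n)) (one : p ident)
    (mul : ∀ x ∈ Asub A n, ∀ y ∈ Asub A n, p x → p y → p (dmul x y))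
    (inv : ∀ x ∈ Asub A n, p x → p (dinv x)) {x : A} (hx : x ∈ Asub A n) : p x := by
  induction hx with
  | mem hx =>
    obtain ⟨s, hs, e, a, rfl⟩ := hx
    obtain ⟨k, rfl⟩ := Nat.exists_eq_add_of_le hs
    obtain ⟨a', h⟩ := exists_evalW_add e a n k
    exact h ▸ mem e a'
  | one => exact one
  | mul hx hy ihx ihy => exact mul _ hx _ hy ihx ihy
  | inv hx ih => exact inv _ hx ih

end Asub

section Isoclinism

variable {A B C : Type u} [SkewBrace A] [SkewBrace B] [SkewBrace C] {n : ℕ}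

theorem IsoclinicN.symm (h : IsoclinicN A B n) : IsoclinicN B A n := by
  obtain ⟨ξ, θ, h⟩ := h
  obtain ⟨P, _, f, hf, -, hfk⟩ := exists_hom_ker_annS A n
  obtain ⟨Q, _, g, hg, -, hgk⟩ := exists_hom_ker_annS B n
  have relA {a a' : A} := hf.cosetRel_iff hfk (a := a) (b := a')
  have relB {b b' : B} := hg.cosetRel_iff hgk (a := b) (b := b')
  have hresp := h.xi_resp
  have hmul := h.xi_dmul
  have hcmul := h.xi_cmul
  have hcompat := h.compat
  choose η hη using h.xi_surj
  simp only [relA, relB] at hresp hη hmul hcmul hcompat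
  have : Nonempty A := ⟨ident⟩
  choose! τ hτm hτ using h.theta_surj
  refine ⟨η, τ, ?_⟩
  constructor
  · intro b b'
    rw [relA, relB, hresp, ← hη, ← hη]
  · intro a
    refine ⟨ξ a, ?_⟩
    rw [relA, hresp, ← hη]
  · intro b b'
    rw [relA, hresp, ← hη, ← hmul, hg.map_dmul, hg.map_dmul, ← hη, ← hη]
  · intro b b'
    rw [relA, hresp, ← hη, ← hcmul, hg.map_cmul, hg.map_cmul, ← hη, ← hη]
  · exact hτm
  · intro x hx y hy hxy
    rw [← hτ x hx, hxy, hτ y hy]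
  · intro x hx
    exact ⟨θ x, h.theta_maps x hx, h.theta_inj _ (hτm _ (h.theta_maps x hx)) _ hx
      (hτ _ (h.theta_maps x hx))⟩
  · intro x hx y hy
    refine h.theta_inj _ (hτm _ (dmul_mem_Asub hx hy)) _
      (dmul_mem_Asub (hτm x hx) (hτm y hy)) ?_
    rw [hτ _ (dmul_mem_Asub hx hy), h.theta_dmul _ (hτm x hx) _ (hτm y hy), hτ x hx, hτ y hy]
  · intro x hx y hy
    refine h.theta_inj _ (hτm _ (cmul_mem_Asub hx hy)) _
      (cmul_mem_Asub (hτm x hx) (hτm y hy)) ?_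
    rw [hτ _ (cmul_mem_Asub hx hy), h.theta_cmul _ (hτm x hx) _ (hτm y hy), hτ x hx, hτ y hy]
  · intro e b a hab
    simp only [relA, hresp, ← hη] at hab
    refine h.theta_inj _ (hτm _ (evalW_mem_Asub e b n)) _ (evalW_mem_Asub e a n) ?_
    rw [hτ _ (evalW_mem_Asub e b n), hcompat e a b fun i hi => (hab i hi).symm]

theorem IsoclinicN.trans (h₁ : IsoclinicN A B n) (h₂ : IsoclinicN B C n) : IsoclinicN A C n := by
  obtain ⟨ξ, θ, h₁⟩ := h₁
  obtain ⟨η, τ, h₂⟩ := h₂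
  obtain ⟨P, _, f, hf, -, hfk⟩ := exists_hom_ker_annS B n
  obtain ⟨Q, _, g, hg, -, hgk⟩ := exists_hom_ker_annS C n
  have relB {a a' : B} := hf.cosetRel_iff hfk (a := a) (b := a')
  have relC {b b' : C} := hg.cosetRel_iff hgk (a := b) (b := b')
  have hresp {b b' : B} : f b = f b' ↔ g (η b) = g (η b') := by
    rw [← relB, ← relC, h₂.xi_resp]
  refine ⟨η ∘ ξ, τ ∘ θ, ?_⟩
  constructor
  · intro a a'
    rw [h₁.xi_resp, h₂.xi_resp]
    rfl
  · intro c
    obtain ⟨b, hb⟩ := h₂.xi_surj c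
    obtain ⟨a, ha⟩ := h₁.xi_surj b
    refine ⟨a, ?_⟩
    rw [relC] at hb ⊢
    rw [relB, hresp] at ha
    exact hb.trans ha
  · intro a a'
    have h := h₁.xi_dmul a a'
    rw [relB, hresp] at h
    rw [relC]
    exact (relC.1 (h₂.xi_dmul _ _)).trans h
  · intro a a'
    have h := h₁.xi_cmul a a'
    rw [relB, hresp] at h
    rw [relC]
    exact (relC.1 (h₂.xi_cmul _ _)).trans h
  · exact fun x hx => h₂.theta_maps _ (h₁.theta_maps x hx)
  · exact fun x hx y hy hxy => h₁.theta_inj x hx y hy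
      (h₂.theta_inj _ (h₁.theta_maps x hx) _ (h₁.theta_maps y hy) hxy)
  · intro z hz
    obtain ⟨y, hy, rfl⟩ := h₂.theta_surj z hz
    obtain ⟨x, hx, rfl⟩ := h₁.theta_surj y hy
    exact ⟨x, hx, rfl⟩
  · intro x hx y hy
    simp only [Function.comp_apply]
    rw [h₁.theta_dmul x hx y hy, h₂.theta_dmul _ (h₁.theta_maps x hx) _ (h₁.theta_maps y hy)]
  · intro x hx y hy
    simp only [Function.comp_apply]
    rw [h₁.theta_cmul x hx y hy, h₂.theta_cmul _ (h₁.theta_maps x hx) _ (h₁.theta_maps y hy)]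
  · intro e a c hac
    simp only [Function.comp_apply]
    rw [h₁.compat e a (fun i => ξ (a i)) fun i _ => relB.2 rfl]
    exact h₂.compat e _ c hac

/-- Existence of an `n`-isoclinism from `A` forces `A` to lie in the class `I_n`. -/
theorem IsoclinismDataN.inClass {ξ θ : A → B} (h : IsoclinismDataN A B n ξ θ) : InClass A n := by
  intro e a a' haa'
  obtain ⟨Q, _, g, hg, -, hgk⟩ := exists_hom_ker_annS B n
  have relB {b b' : B} := hg.cosetRel_iff hgk (a := b) (b := b')
  refine h.theta_inj _ (evalW_mem_Asub e a' n) _ (evalW_mem_Asub e a n) ?_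
  rw [h.compat e a (fun i => ξ (a' i)) fun i hi =>
      relB.2 (relB.1 ((h.xi_resp _ _).1 (haa' i hi))).symm,
    h.compat e a' (fun i => ξ (a' i)) fun i _ => relB.2 rfl]

lemma mem_annS_of_proj {p : C → A} {q : C → B} (hp : IsBraceHom p) (hq : IsBraceHom q)
    (hinj : ∀ c, p c = ident → q c = ident → c = ident) (n : ℕ) {c : C}
    (hpc : p c ∈ AnnS A n) (hqc : q c ∈ AnnS B n) : c ∈ AnnS C n := by
  induction n generalizing c with
  | zero => exact hinj c hpc hqc
  | succ n ih =>
    intro d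
    obtain ⟨h₁, h₂, h₃⟩ := hpc (p d)
    obtain ⟨k₁, k₂, k₃⟩ := hqc (q d)
    simp only [← hp.map_bstar, ← hp.map_dcomm] at h₁ h₂ h₃
    simp only [← hq.map_bstar, ← hq.map_dcomm] at k₁ k₂ k₃
    exact ⟨ih h₁ k₁, ih h₂ k₂, ih h₃ k₃⟩

lemma IsBraceHom.map_annS {p : C → A} (hp : IsBraceHom p) (hs : Function.Surjective p) (n : ℕ)
    {c : C} (hc : c ∈ AnnS C n) : p c ∈ AnnS A n := by
  induction n generalizing c with
  | zero => exact (congrArg p hc).trans hp.map_ident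
  | succ n ih =>
    refine hs.forall.2 fun d => ?_
    obtain ⟨h₁, h₂, h₃⟩ := hc d
    rw [← hp.map_bstar, ← hp.map_bstar, ← hp.map_dcomm]
    exact ⟨ih h₁, ih h₂, ih h₃⟩

/-- A fibre product of `A` and `B` over an `n`-isoclinism is `n`-isoclinic to `A` through its
projection. -/
theorem IsoclinismDataN.of_fiber {ξ θ : A → B} (h : IsoclinismDataN A B n ξ θ) {p : C → A}
    {q : C → B} (hp : IsBraceHom p) (hq : IsBraceHom q) (hps : Function.Surjective p)
    (hinj : ∀ c c', p c = p c' → q c = q c' → c = c')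
    (hfib : ∀ c, cosetRel (AnnS B n) (q c) (ξ (p c))) : IsoclinismDataN C A n p p := by
  obtain ⟨P, _, f, hf, -, hfk⟩ := exists_hom_ker_annS A n
  obtain ⟨Q, _, g, hg, -, hgk⟩ := exists_hom_ker_annS B n
  have relA {a a' : A} := hf.cosetRel_iff hfk (a := a) (b := a')
  have relB {b b' : B} := hg.cosetRel_iff hgk (a := b) (b := b')
  have graph : ∀ x ∈ Asub C n, p x ∈ Asub A n ∧ q x = θ (p x) := by
    have θ_ident : θ ident = ident := dmul_left_cancel (a := θ ident) (by
      rw [← h.theta_dmul _ (ident_mem_Asub n) _ (ident_mem_Asub n), dmul_ident, dmul_ident])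
    intro x hx
    refine Asub_induction (p := fun x => p x ∈ Asub A n ∧ q x = θ (p x)) ?_ ?_ ?_ ?_ hx
    · intro e c
      rw [hp.map_evalW, hq.map_evalW]
      exact ⟨evalW_mem_Asub _ _ _, (h.compat e _ _ fun i _ => hfib (c i)).symm⟩
    · rw [hp.map_ident, hq.map_ident]
      exact ⟨ident_mem_Asub n, θ_ident.symm⟩
    · rintro x - y - ⟨hx, hx'⟩ ⟨hy, hy'⟩
      rw [hp.map_dmul, hq.map_dmul, h.theta_dmul _ hx _ hy, hx', hy']
      exact ⟨dmul_mem_Asub hx hy, rfl⟩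
    · rintro x - ⟨hx, hx'⟩
      rw [hp.map_dinv, hq.map_dinv, hx']
      refine ⟨dinv_mem_Asub hx, dinv_eq_of_dmul ?_⟩
      rw [← h.theta_dmul _ hx _ (dinv_mem_Asub hx), dmul_dinv, θ_ident]
  constructor
  · intro c c'
    constructor
    · rintro ⟨d, hd, rfl⟩
      exact ⟨p d, hp.map_annS hps n hd, hp.map_dmul _ _⟩
    · intro hcc'
      have hqq : g (q c) = g (q c') := by
        rw [relB.1 (hfib c), relB.1 (hfib c'), ← relB, ← h.xi_resp]
        exact hcc'
      rw [relA] at hcc'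
      refine ⟨dmul c' (dinv c), mem_annS_of_proj hp hq (fun c h₁ h₂ => hinj _ _
        (h₁.trans hp.map_ident.symm) (h₂.trans hq.map_ident.symm)) n ((hfk _).1 ?_)
        ((hgk _).1 ?_), (dinv_dmul_cancel_right _ _).symm⟩
      · rw [hp.map_dmul, hp.map_dinv, hf.map_dmul, hf.map_dinv, hcc', dmul_dinv]
      · rw [hq.map_dmul, hq.map_dinv, hg.map_dmul, hg.map_dinv, hqq, dmul_dinv]
  · intro a
    obtain ⟨c, rfl⟩ := hps a
    exact ⟨c, relA.2 rfl⟩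
  · exact fun a a' => relA.2 (by rw [hp.map_dmul])
  · exact fun a a' => relA.2 (by rw [hp.map_cmul])
  · exact fun x hx => (graph x hx).1
  · intro x hx y hy hxy
    exact hinj x y hxy (by rw [(graph x hx).2, (graph y hy).2, hxy])
  · intro y hy
    refine Asub_induction (p := fun y => ∃ x ∈ Asub C n, p x = y) ?_ ?_ ?_ ?_ hy
    · intro e a
      choose c hc using fun i => hps (a i)
      refine ⟨evalW e c n, evalW_mem_Asub _ _ _, ?_⟩
      simp only [hp.map_evalW, hc]
    · exact ⟨ident, ident_mem_Asub n, hp.map_ident⟩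
    · rintro _ - _ - ⟨x, hx, rfl⟩ ⟨y, hy, rfl⟩
      exact ⟨dmul x y, dmul_mem_Asub hx hy, hp.map_dmul _ _⟩
    · rintro _ - ⟨x, hx, rfl⟩
      exact ⟨dinv x, dinv_mem_Asub hx, hp.map_dinv _⟩
  · exact fun x _ y _ => hp.map_dmul x y
  · exact fun x _ y _ => hp.map_cmul x y
  · intro e c a hac
    rw [hp.map_evalW]
    exact h.inClass e a _ hac

end Isoclinism

end SkewBrace

/-- Two symmetric skew braces `A, B` are `n`-isoclinic if and only if there exist a skew brace
`C` and ideals `N₁, N₂` of `C` such that `A ≅ C/N₂`, `B ≅ C/N₁`, and `C` is `n`-isoclinic to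
both `A` and `B`. -/
theorem isoclinicN_iff_common_quotient {A B : Type u} [SkewBrace A] [SkewBrace B]
    (hA : IsSymmetric A) (hB : IsSymmetric B) (n : ℕ) (hn : 1 ≤ n) :
    IsoclinicN A B n ↔ ∃ (C : Type u) (iC : SkewBrace C), @Stmt12Concl A B _ _ n C iC := by
  constructor
  · rintro ⟨ξ, θ, h⟩
    obtain ⟨Q, _, g, hg, -, hgk⟩ := exists_hom_ker_annS B n
    have relB {b b' : B} := hg.cosetRel_iff hgk (a := b) (b := b')
    have hgξ : IsBraceHom fun a => g (ξ a) :=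
      ⟨fun x y => by rw [← hg.map_dmul, relB.1 (h.xi_dmul x y)],
        fun x y => by rw [← hg.map_cmul, relB.1 (h.xi_cmul x y)]⟩
    have hS : IsSubBrace (A × B) {x | g x.2 = g (ξ x.1)} :=
      { ident_mem := hg.map_ident.trans hgξ.map_ident.symm
        dmul_mem := fun {x y} hx hy => ((hg.map_dmul _ _).trans
          (congrArg₂ dmul hx hy)).trans (hgξ.map_dmul x.1 y.1).symm
        dinv_mem := fun {x} hx => ((hg.map_dinv _).trans
          (congrArg dinv hx)).trans (hgξ.map_dinv x.1).symm
        cmul_mem := fun {x y} hx hy => ((hg.map_cmul _ _).trans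
          (congrArg₂ cmul hx hy)).trans (hgξ.map_cmul x.1 y.1).symm
        cinv_mem := fun {x} hx => ((hg.map_cinv _).trans
          (congrArg cinv hx)).trans (hgξ.map_cinv x.1).symm }
    let iC := subBrace _ hS
    let p : {x : A × B | g x.2 = g (ξ x.1)} → A := fun c => c.1.1
    let q : {x : A × B | g x.2 = g (ξ x.1)} → B := fun c => c.1.2
    have hp : IsBraceHom p := ⟨fun _ _ => rfl, fun _ _ => rfl⟩
    have hq : IsBraceHom q := ⟨fun _ _ => rfl, fun _ _ => rfl⟩
    have hps : Function.Surjective p := fun a => ⟨⟨(a, ξ a), rfl⟩, rfl⟩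
    have hqs : Function.Surjective q := fun b =>
      (h.xi_surj b).elim fun a ha => ⟨⟨(a, b), relB.1 ha⟩, rfl⟩
    have hCA := h.of_fiber hp hq hps
      (fun c c' h₁ h₂ => Subtype.ext (Prod.ext h₁ h₂)) (fun c => relB.2 c.2)
    exact ⟨_, iC, _, _, p, q, hq.isIdeal_ker, hp.isIdeal_ker, hp, hps, fun _ => Iff.rfl,
      hq, hqs, fun _ => Iff.rfl, ⟨p, p, hCA⟩, IsoclinicN.trans ⟨p, p, hCA⟩ ⟨ξ, θ, h⟩⟩
  · rintro ⟨C, iC, -, -, -, -, -, -, -, -, -, -, -, -, hCA, hCB⟩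
    exact hCA.symm.trans hCB
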